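/- Next-unfolding theorem: for all metric formulas φ, ψ over A and all m, n ∈ ℕ with 0 < m < n−1, the following equivalences hold over strict timed HT-traces (writing [i,i] for [i,i+1) and [0,j] for [0,j+1)): ψ U_{[m,n)} φ ≡ ψ ∧ ( ⋁_{i=1}^{m} ○_{[i,i]}(ψ U_{[m−i,n−i)} φ) ∨ ⋁_{i=m+1}^{n−1} ○_{[i,i]}(ψ U_{[0,n−1−i]} φ) ); ψ R_{[m,n)} φ ≡ ψ ∨ ( ⋀_{i=1}^{m} ○̂_{[i,i]}(ψ R_{[m−i,n−i)} φ) ∧ ⋀_{i=m+1}^{n−1} ○̂_{[i,i]}(ψ R_{[0,n−1−i]} φ) ). -/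

import Mathlib

/-- Metric formulas over an alphabet `A`.  Each temporal operator carries an
interval `[m, n)` with `m : ℕ` and `n : ℕ∞` (where `⊤` plays the role of `ω`). -/
inductive MForm (A : Type) : Type where
  | bot  : MForm A
  | atom : A → MForm A
  | conj : MForm A → MForm A → MForm A
  | disj : MForm A → MForm A → MForm A
  | impl : MForm A → MForm A → MForm A
  | prev  : ℕ → ℕ∞ → MForm A → MForm A
  | since : ℕ → ℕ∞ → MForm A → MForm A → MForm A
  | trig  : ℕ → ℕ∞ → MForm A → MForm A → MForm A
  | next  : ℕ → ℕ∞ → MForm A → MForm A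
  | untl  : ℕ → ℕ∞ → MForm A → MForm A → MForm A
  | rel   : ℕ → ℕ∞ → MForm A → MForm A → MForm A

/-- Membership of a duration `d` in the interval `[m, n)`. -/
def inIntv (m : ℕ) (n : ℕ∞) (d : ℕ) : Prop := m ≤ d ∧ (d : ℕ∞) < n

/-- Satisfaction `(⟨H,T⟩,τ), k ⊨ φ` for a timed HT-trace of length `len`. -/
def sat {A : Type} : MForm A → (ℕ → Set A) → (ℕ → Set A) → (ℕ → ℕ) → ℕ∞ → ℕ → Prop
  | .bot, _, _, _, _, _ => False
  | .atom p, H, _, _, _, k => p ∈ H k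
  | .conj φ ψ, H, T, τ, len, k => sat φ H T τ len k ∧ sat ψ H T τ len k
  | .disj φ ψ, H, T, τ, len, k => sat φ H T τ len k ∨ sat ψ H T τ len k
  | .impl φ ψ, H, T, τ, len, k =>
      (¬ sat φ H T τ len k ∨ sat ψ H T τ len k) ∧
      (¬ sat φ T T τ len k ∨ sat ψ T T τ len k)
  | .prev m n φ, H, T, τ, len, k =>
      0 < k ∧ sat φ H T τ len (k-1) ∧ inIntv m n (τ k - τ (k-1))
  | .since m n φ ψ, H, T, τ, len, k =>
      ∃ j, j ≤ k ∧ inIntv m n (τ k - τ j) ∧ sat ψ H T τ len j ∧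
        ∀ i, j < i → i ≤ k → sat φ H T τ len i
  | .trig m n φ ψ, H, T, τ, len, k =>
      ∀ j, j ≤ k → inIntv m n (τ k - τ j) →
        (sat ψ H T τ len j ∨ ∃ i, j < i ∧ i ≤ k ∧ sat φ H T τ len i)
  | .next m n φ, H, T, τ, len, k =>
      (k : ℕ∞) + 1 < len ∧ sat φ H T τ len (k+1) ∧ inIntv m n (τ (k+1) - τ k)
  | .untl m n φ ψ, H, T, τ, len, k =>
      ∃ j, k ≤ j ∧ (j : ℕ∞) < len ∧ inIntv m n (τ j - τ k) ∧ sat ψ H T τ len j ∧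
        ∀ i, k ≤ i → i < j → sat φ H T τ len i
  | .rel m n φ ψ, H, T, τ, len, k =>
      ∀ j, k ≤ j → (j : ℕ∞) < len → inIntv m n (τ j - τ k) →
        (sat ψ H T τ len j ∨ ∃ i, k ≤ i ∧ i < j ∧ sat φ H T τ len i)

/-- `(⟨H,T⟩,τ)` is a timed HT-trace of length `len`. -/
def isTrace {A : Type} (H T : ℕ → Set A) (τ : ℕ → ℕ) (len : ℕ∞) : Prop :=
  (∀ i : ℕ, (i : ℕ∞) < len → H i ⊆ T i) ∧
  (∀ i : ℕ, (i : ℕ∞) + 1 < len → τ i ≤ τ (i+1)) ∧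
  τ 0 = 0

/-- Strict timing. -/
def isStrict (τ : ℕ → ℕ) (len : ℕ∞) : Prop :=
  ∀ i : ℕ, (i : ℕ∞) + 1 < len → τ i < τ (i+1)

/-- Negation `¬φ := φ → ⊥`. -/
def mNeg {A : Type} (φ : MForm A) : MForm A := MForm.impl φ MForm.bot

/-- `⊤ := ¬⊥`. -/
def mTop {A : Type} : MForm A := mNeg MForm.bot

/-- Eventually `◇_I φ := ⊤ U_I φ`. -/
def mEvent {A : Type} (m : ℕ) (n : ℕ∞) (φ : MForm A) : MForm A := MForm.untl m n mTop φ

/-- Always `◻_I φ := ⊥ R_I φ`. -/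
def mAlways {A : Type} (m : ℕ) (n : ℕ∞) (φ : MForm A) : MForm A := MForm.rel m n MForm.bot φ

/-- Eventually-before `◆_I φ := ⊤ S_I φ`. -/
def mEvB {A : Type} (m : ℕ) (n : ℕ∞) (φ : MForm A) : MForm A := MForm.since m n mTop φ

/-- Always-before `■_I φ := ⊥ T_I φ`. -/
def mAlwB {A : Type} (m : ℕ) (n : ℕ∞) (φ : MForm A) : MForm A := MForm.trig m n MForm.bot φ

/-- Weak next `○̂_I φ := ○_I φ ∨ ¬○_I ⊤`. -/
def mWNext {A : Type} (m : ℕ) (n : ℕ∞) (φ : MForm A) : MForm A :=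
  MForm.disj (MForm.next m n φ) (mNeg (MForm.next m n mTop))

/-- Weak previous `•̂_I φ := •_I φ ∨ ¬•_I ⊤`. -/
def mWPrev {A : Type} (m : ℕ) (n : ℕ∞) (φ : MForm A) : MForm A :=
  MForm.disj (MForm.prev m n φ) (mNeg (MForm.prev m n mTop))

/-- MHT-equivalence over strict timed HT-traces. -/
def mhtEquivStrict {A : Type} (φ ψ : MForm A) : Prop :=
  ∀ (H T : ℕ → Set A) (τ : ℕ → ℕ) (len : ℕ∞),
    isTrace H T τ len → isStrict τ len → ∀ k : ℕ, (k : ℕ∞) < len →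
      (sat φ H T τ len k ↔ sat ψ H T τ len k)

/-- Finite disjunction of a list of formulas (`⊥` for the empty list). -/
def bigOr {A : Type} : List (MForm A) → MForm A
  | [] => MForm.bot
  | f :: fs => MForm.disj f (bigOr fs)

/-- Finite conjunction of a list of formulas (`⊤` for the empty list). -/
def bigAnd {A : Type} : List (MForm A) → MForm A
  | [] => mTop
  | f :: fs => MForm.conj f (bigAnd fs)

theorem sat_bigOr_map {A ι : Type} (f : ι → MForm A) (l : List ι) (H T : ℕ → Set A)
    (τ : ℕ → ℕ) (len : ℕ∞) (k : ℕ) :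
    sat (bigOr (l.map f)) H T τ len k ↔ ∃ j ∈ l, sat (f j) H T τ len k := by
  induction l with
  | nil => simp [bigOr, sat]
  | cons a l ih => simp [bigOr, sat, ih]

theorem sat_next {A : Type} (m : ℕ) (n : ℕ∞) (φ : MForm A) (H T : ℕ → Set A)
    (τ : ℕ → ℕ) (len : ℕ∞) (k : ℕ) :
    sat (MForm.next m n φ) H T τ len k ↔
      (k : ℕ∞) + 1 < len ∧ sat φ H T τ len (k + 1) ∧ inIntv m n (τ (k + 1) - τ k) := by
  rw [sat]

theorem sat_mTop {A : Type} (H T : ℕ → Set A) (τ : ℕ → ℕ) (len : ℕ∞) (k : ℕ) :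
    sat (mTop : MForm A) H T τ len k := by
  simp [mTop, mNeg, sat]

theorem sat_bigAnd_map {A ι : Type} (f : ι → MForm A) (l : List ι) (H T : ℕ → Set A)
    (τ : ℕ → ℕ) (len : ℕ∞) (k : ℕ) :
    sat (bigAnd (l.map f)) H T τ len k ↔ ∀ j ∈ l, sat (f j) H T τ len k := by
  induction l with
  | nil => simp [bigAnd, sat_mTop]
  | cons a l ih => simp [bigAnd, sat, ih]

theorem sat_mWNext {A : Type} (m : ℕ) (n : ℕ∞) (φ : MForm A) (H T : ℕ → Set A)
    (τ : ℕ → ℕ) (len : ℕ∞) (k : ℕ) :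
    sat (mWNext m n φ) H T τ len k ↔
      ((k : ℕ∞) + 1 < len → inIntv m n (τ (k + 1) - τ k) → sat φ H T τ len (k + 1)) := by
  simp only [mWNext, mNeg, sat, sat_mTop]
  tauto

theorem inIntv_natCast {m n d : ℕ} : inIntv m (n : ℕ∞) d ↔ m ≤ d ∧ d < n := by
  simp [inIntv]

theorem inIntv_natCast_add_one {m n d : ℕ} : inIntv m ((n : ℕ∞) + 1) d ↔ m ≤ d ∧ d < n + 1 := by
  exact_mod_cast inIntv_natCast (n := n + 1)

theorem inIntv_natCast_add_two {m n d : ℕ} : inIntv m ((n : ℕ∞) + 2) d ↔ m ≤ d ∧ d < n + 2 := by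
  exact_mod_cast inIntv_natCast (n := n + 2)

theorem isTrace.timestamp_le {A : Type} {H T : ℕ → Set A} {τ : ℕ → ℕ} {len : ℕ∞}
    (h : isTrace H T τ len) {i j : ℕ} (hij : i ≤ j) (hj : (j : ℕ∞) < len) : τ i ≤ τ j := by
  induction j, hij using Nat.le_induction with
  | base => exact le_rfl
  | succ j _ ih =>
    have hj' : (j : ℕ∞) + 1 < len := by exact_mod_cast hj
    exact (ih (lt_of_le_of_lt le_self_add hj')).trans (h.2.1 j hj')

/-- Moving the reference point one step forward shifts the interval by the elapsed time. -/
theorem isTrace.inIntv_succ_iff {A : Type} {H T : ℕ → Set A} {τ : ℕ → ℕ} {len : ℕ∞}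
    (h : isTrace H T τ len) {j k : ℕ} (hkj : k + 1 ≤ j) (hj : (j : ℕ∞) < len) (m n : ℕ) :
    inIntv m (n : ℕ∞) (τ j - τ k) ↔
      inIntv (m - (τ (k + 1) - τ k)) ((n - (τ (k + 1) - τ k) : ℕ) : ℕ∞) (τ j - τ (k + 1)) := by
  have h1 := h.timestamp_le hkj hj
  have h2 := h.timestamp_le k.le_succ (lt_of_le_of_lt (by exact_mod_cast hkj) hj)
  rw [inIntv_natCast, inIntv_natCast]
  simp only [Nat.succ_eq_add_one] at h2
  omega

/-- One-step unfolding of a metric until whose interval excludes `0`. -/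
theorem isTrace.sat_untl_iff {A : Type} {H T : ℕ → Set A} {τ : ℕ → ℕ} {len : ℕ∞}
    (h : isTrace H T τ len) (φ ψ : MForm A) {m : ℕ} (hm : 0 < m) (n k : ℕ) :
    sat (MForm.untl m (n : ℕ∞) ψ φ) H T τ len k ↔
      sat ψ H T τ len k ∧ (k : ℕ∞) + 1 < len ∧
        sat (MForm.untl (m - (τ (k + 1) - τ k)) ((n - (τ (k + 1) - τ k) : ℕ) : ℕ∞) ψ φ)
          H T τ len (k + 1) := by
  simp only [sat]
  constructor
  · rintro ⟨j, hkj, hj, hI, hφ, hψ⟩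
    have hne : k ≠ j := by
      rintro rfl
      have := hI.1
      omega
    have hkj' : k + 1 ≤ j := by omega
    exact ⟨hψ k le_rfl (by omega), lt_of_le_of_lt (by exact_mod_cast hkj') hj, j, hkj', hj,
      (h.inIntv_succ_iff hkj' hj m n).1 hI, hφ, fun i hi => hψ i (by omega)⟩
  · rintro ⟨hk, -, j, hkj, hj, hI, hφ, hψ⟩
    refine ⟨j, by omega, hj, (h.inIntv_succ_iff hkj hj m n).2 hI, hφ, fun i hi hij => ?_⟩
    rcases hi.eq_or_lt with rfl | hi
    · exact hk
    · exact hψ i hi hij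

/-- One-step unfolding of a metric release whose interval excludes `0`. -/
theorem isTrace.sat_rel_iff {A : Type} {H T : ℕ → Set A} {τ : ℕ → ℕ} {len : ℕ∞}
    (h : isTrace H T τ len) (φ ψ : MForm A) {m : ℕ} (hm : 0 < m) (n k : ℕ) :
    sat (MForm.rel m (n : ℕ∞) ψ φ) H T τ len k ↔
      sat ψ H T τ len k ∨ ((k : ℕ∞) + 1 < len →
        sat (MForm.rel (m - (τ (k + 1) - τ k)) ((n - (τ (k + 1) - τ k) : ℕ) : ℕ∞) ψ φ)
          H T τ len (k + 1)) := by
  simp only [sat]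
  constructor
  · intro hR
    refine or_iff_not_imp_left.2 fun hk _ j hkj hj hI => ?_
    refine (hR j (by omega) hj ((h.inIntv_succ_iff hkj hj m n).2 hI)).imp_right ?_
    rintro ⟨i, hi, hij, hψ⟩
    rcases hi.eq_or_lt with rfl | hi
    · exact absurd hψ hk
    · exact ⟨i, hi, hij, hψ⟩
  · intro hR j hkj hj hI
    have hne : k ≠ j := by
      rintro rfl
      have := hI.1
      omega
    have hkj' : k + 1 ≤ j := by omega
    rcases hR with hk | hR
    · exact Or.inr ⟨k, le_rfl, by omega, hk⟩
    · refine (hR (lt_of_le_of_lt (by exact_mod_cast hkj') hj) j hkj' hj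
        ((h.inIntv_succ_iff hkj' hj m n).1 hI)).imp_right ?_
      rintro ⟨i, hi, hij, hψ⟩
      exact ⟨i, by omega, hij, hψ⟩

theorem not_sat_untl_zero {A : Type} (m : ℕ) (φ ψ : MForm A) (H T : ℕ → Set A)
    (τ : ℕ → ℕ) (len : ℕ∞) (k : ℕ) : ¬ sat (MForm.untl m ((0 : ℕ) : ℕ∞) ψ φ) H T τ len k := by
  simp [sat, inIntv]

theorem sat_rel_zero {A : Type} (m : ℕ) (φ ψ : MForm A) (H T : ℕ → Set A)
    (τ : ℕ → ℕ) (len : ℕ∞) (k : ℕ) : sat (MForm.rel m ((0 : ℕ) : ℕ∞) ψ φ) H T τ len k := by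
  simp [sat, inIntv]

/-- Next-unfolding theorem (Theorem 2). -/
theorem next_unfolding {A : Type} (φ ψ : MForm A) (m n : ℕ)
    (hm : 0 < m) (hmn : m < n - 1) :
    mhtEquivStrict (MForm.untl m (n : ℕ∞) ψ φ)
      (MForm.conj ψ (MForm.disj
        (bigOr ((List.range m).map (fun j =>
          MForm.next (j+1) ((j : ℕ∞) + 2)
            (MForm.untl (m - (j+1)) ((n - (j+1) : ℕ) : ℕ∞) ψ φ))))
        (bigOr ((List.range (n - 1 - m)).map (fun j =>
          MForm.next (m+1+j) (((m+1+j : ℕ) : ℕ∞) + 1)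
            (MForm.untl 0 (((n - 1 - (m+1+j) : ℕ) : ℕ∞) + 1) ψ φ)))))) ∧
    mhtEquivStrict (MForm.rel m (n : ℕ∞) ψ φ)
      (MForm.disj ψ (MForm.conj
        (bigAnd ((List.range m).map (fun j =>
          mWNext (j+1) ((j : ℕ∞) + 2)
            (MForm.rel (m - (j+1)) ((n - (j+1) : ℕ) : ℕ∞) ψ φ))))
        (bigAnd ((List.range (n - 1 - m)).map (fun j =>
          mWNext (m+1+j) (((m+1+j : ℕ) : ℕ∞) + 1)
            (MForm.rel 0 (((n - 1 - (m+1+j) : ℕ) : ℕ∞) + 1) ψ φ)))))) := by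
  have hcast : ∀ d, d < n → (((n - 1 - d : ℕ) : ℕ∞) + 1) = ((n - d : ℕ) : ℕ∞) := by
    intro d hd
    rw [show n - d = n - 1 - d + 1 by omega]
    push_cast
    rfl
  constructor
  · intro H T τ len hT hS k _
    rw [hT.sat_untl_iff φ ψ hm, sat, sat, sat_bigOr_map, sat_bigOr_map]
    refine and_congr_right fun _ => ?_
    simp only [List.mem_range, sat_next, inIntv_natCast_add_one, inIntv_natCast_add_two]
    constructor
    · rintro ⟨hk, hU⟩
      have hd := hS k hk
      rcases le_or_gt (τ (k + 1) - τ k) m with hdm | hdm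
      · refine Or.inl ⟨τ (k + 1) - τ k - 1, by omega, hk, ?_, by omega, by omega⟩
        rwa [show τ (k + 1) - τ k - 1 + 1 = τ (k + 1) - τ k by omega]
      · have hdn : τ (k + 1) - τ k < n := by
          by_contra hdn
          rw [Nat.sub_eq_zero_of_le (not_lt.1 hdn)] at hU
          exact not_sat_untl_zero _ _ _ _ _ _ _ _ hU
        refine Or.inr ⟨τ (k + 1) - τ k - (m + 1), by omega, hk, ?_, by omega, by omega⟩
        rw [show m + 1 + (τ (k + 1) - τ k - (m + 1)) = τ (k + 1) - τ k by omega, hcast _ hdn]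
        rwa [Nat.sub_eq_zero_of_le hdm.le] at hU
    · rintro (⟨j, hj, hk, hU, h1, h2⟩ | ⟨j, hj, hk, hU, h1, h2⟩)
      · rw [show j + 1 = τ (k + 1) - τ k by omega] at hU
        exact ⟨hk, hU⟩
      · rw [show m + 1 + j = τ (k + 1) - τ k by omega, hcast _ (by omega)] at hU
        rw [Nat.sub_eq_zero_of_le (show m ≤ τ (k + 1) - τ k by omega)]
        exact ⟨hk, hU⟩
  · intro H T τ len hT hS k _
    rw [hT.sat_rel_iff φ ψ hm, sat, sat, sat_bigAnd_map, sat_bigAnd_map]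
    refine or_congr_right ?_
    simp only [List.mem_range, sat_mWNext, inIntv_natCast_add_one, inIntv_natCast_add_two]
    constructor
    · refine fun hR => ⟨fun j hj hk hI => ?_, fun j hj hk hI => ?_⟩
      · rw [show j + 1 = τ (k + 1) - τ k by omega]
        exact hR hk
      · have hR := hR hk
        rw [Nat.sub_eq_zero_of_le (show m ≤ τ (k + 1) - τ k by omega)] at hR
        rwa [show m + 1 + j = τ (k + 1) - τ k by omega, hcast _ (by omega)]
    · rintro ⟨hR₁, hR₂⟩ hk
      have hd := hS k hk
      rcases le_or_gt (τ (k + 1) - τ k) m with hdm | hdm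
      · have hR := hR₁ (τ (k + 1) - τ k - 1) (by omega) hk ⟨by omega, by omega⟩
        rwa [show τ (k + 1) - τ k - 1 + 1 = τ (k + 1) - τ k by omega] at hR
      · rcases lt_or_ge (τ (k + 1) - τ k) n with hdn | hdn
        · have hR := hR₂ (τ (k + 1) - τ k - (m + 1)) (by omega) hk ⟨by omega, by omega⟩
          rw [show m + 1 + (τ (k + 1) - τ k - (m + 1)) = τ (k + 1) - τ k by omega,
            hcast _ hdn] at hR
          rwa [Nat.sub_eq_zero_of_le hdm.le]
        · rw [Nat.sub_eq_zero_of_le hdn]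
          exact sat_rel_zero _ _ _ _ _ _ _ _
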